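/- Let a and b be non-negative integers. The number C(a+b+2, a+1) − C(a+b, a) − 1 is the greatest element of the set of all natural numbers n for which there exists a skew Bollobás system (A_1,B_1),...,(A_m,B_m) with |A_i| ≤ a and |B_i| ≤ b for every i ∈ {1,...,m} and |(A_1 ∪ B_1) ∪ ... ∪ (A_m ∪ B_m)| = n. In other words, the maximum size n_skew(a,b) of the ground set of such systems equals C(a+b+2, a+1) − C(a+b, a) − 1. -/

import Mathlib

/-- A skew Bollobás system: pairs `(A i, B i)` of finite sets with `A i ∩ B i = ∅`
and `A i ∩ B j ≠ ∅` whenever `i < j`. -/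
def IsSkewBollobasSystem (m : ℕ) (A B : Fin m → Finset ℕ) : Prop :=
  (∀ i, Disjoint (A i) (B i)) ∧ (∀ i j : Fin m, i < j → (A i ∩ B j).Nonempty)

/-- Frankl's skew version of Bollobás' theorem: triangularity of a matrix of rank at most
`C(a+b,a)` bounds its size. -/
theorem card_le_choose_of_skew {m : ℕ} (a b : ℕ) (A B : Fin m → Finset ℕ)
    (hAB : ∀ i, Disjoint (A i) (B i)) (hskew : ∀ i j, i < j → (A i ∩ B j).Nonempty)
    (hA : ∀ i, (A i).card ≤ a) (hB : ∀ i, (B i).card ≤ b) :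
    m ≤ (a + b).choose a := by
  classical
  obtain ⟨z, hz⟩ := Infinite.exists_notMem_finset (Finset.univ.biUnion A)
  have hzA : ∀ i, z ∉ A i := fun i hi =>
    hz (Finset.mem_biUnion.2 ⟨i, Finset.mem_univ i, hi⟩)
  let P : Fin m → Polynomial ℚ := fun i => ∏ s ∈ A i, (Polynomial.X - Polynomial.C (s : ℚ))
  let c : Fin m → Fin (a + 1) → ℚ := fun i r => (P i).coeff r
  let ℓ : ℕ → MvPolynomial (Fin (a + 1)) ℚ := fun t =>
    ∑ r : Fin (a + 1), MvPolynomial.C ((t : ℚ) ^ (r : ℕ)) * MvPolynomial.X r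
  let f : Fin m → MvPolynomial (Fin (a + 1)) ℚ := fun j =>
    (∏ t ∈ B j, ℓ t) * ℓ z ^ (b - (B j).card)
  have hℓ : ∀ t, (ℓ t).IsHomogeneous 1 := fun t =>
    MvPolynomial.IsHomogeneous.sum _ _ _ fun r _ => MvPolynomial.isHomogeneous_C_mul_X _ _
  have hf : ∀ j, (f j).IsHomogeneous b := by
    intro j
    have h1 := MvPolynomial.IsHomogeneous.prod (B j) ℓ (fun _ => 1) (fun t _ => hℓ t)
    have h2 := h1.mul ((hℓ z).pow (b - (B j).card))
    have h3 : ∑ _t ∈ B j, 1 + 1 * (b - (B j).card) = b := by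
      have := hB j
      simp
      omega
    rwa [h3] at h2
  have hdeg : ∀ i, (P i).natDegree < a + 1 := by
    intro i
    have : (P i).natDegree = (A i).card := by
      rw [Polynomial.natDegree_prod _ _ fun s _ => Polynomial.X_sub_C_ne_zero _]
      simp only [Polynomial.natDegree_X_sub_C, Finset.sum_const, smul_eq_mul, mul_one]
    have := hA i
    omega
  have hevalℓ : ∀ i t, MvPolynomial.eval (c i) (ℓ t) = ∏ s ∈ A i, ((t : ℚ) - s) := by
    intro i t
    have h1 : (P i).eval (t : ℚ) = ∏ s ∈ A i, ((t : ℚ) - s) := by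
      simp [P, Polynomial.eval_prod]
    rw [← h1, Polynomial.eval_eq_sum_range' (hdeg i), Finset.sum_range]
    simp [ℓ, c, mul_comm]
  have hℓ0 : ∀ i t, MvPolynomial.eval (c i) (ℓ t) = 0 ↔ t ∈ A i := by
    intro i t
    rw [hevalℓ, Finset.prod_eq_zero_iff]
    constructor
    · rintro ⟨s, hs, h⟩
      have : t = s := by exact_mod_cast sub_eq_zero.1 h
      rwa [this]
    · exact fun h => ⟨t, h, sub_self _⟩
  have hfdiag : ∀ i, MvPolynomial.eval (c i) (f i) ≠ 0 := by
    intro i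
    simp only [f, map_mul, map_prod, map_pow]
    refine mul_ne_zero (Finset.prod_ne_zero_iff.2 fun t ht h => ?_) (pow_ne_zero _ ?_)
    · exact Finset.disjoint_left.1 (hAB i) ((hℓ0 i t).1 h) ht
    · exact fun h => hzA i ((hℓ0 i z).1 h)
  have hfzero : ∀ i j, i < j → MvPolynomial.eval (c i) (f j) = 0 := by
    intro i j hij
    obtain ⟨t, ht⟩ := hskew i j hij
    rw [Finset.mem_inter] at ht
    simp only [f, map_mul, map_prod]
    rw [Finset.prod_eq_zero ht.2 ((hℓ0 i t).2 ht.1), zero_mul]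
  let S : Finset (Fin (a + 1) →₀ ℕ) := Finset.finsuppAntidiag Finset.univ b
  let V : Matrix (Fin m) S ℚ := fun i d => ∏ r, c i r ^ d.1 r
  let W : Matrix S (Fin m) ℚ := fun d j => (f j).coeff d.1
  have hVW : ∀ i j, (V * W) i j = MvPolynomial.eval (c i) (f j) := by
    intro i j
    have hsub : (f j).support ⊆ S := by
      intro d hd
      have := hf j (MvPolynomial.mem_support_iff.1 hd)
      rw [Finset.mem_finsuppAntidiag]
      refine ⟨?_, Finset.subset_univ _⟩
      rw [← this, Finsupp.weight_apply, Finsupp.sum_fintype] <;> simp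
    rw [MvPolynomial.eval_eq', Matrix.mul_apply,
      Finset.sum_subset hsub (fun d _ hd => by
        rw [MvPolynomial.notMem_support_iff.1 hd, zero_mul])]
    rw [← Finset.sum_coe_sort S]
    exact Finset.sum_congr rfl fun d _ => mul_comm _ _
  have hdet : (V * W).det = ∏ i, (V * W) i i :=
    Matrix.det_of_isLowerTriangular _ (fun i j hij => by
      rw [hVW]; exact hfzero i j hij)
  have hunit : IsUnit (V * W) := by
    rw [Matrix.isUnit_iff_isUnit_det, hdet, isUnit_iff_ne_zero]
    exact Finset.prod_ne_zero_iff.2 fun i _ => by rw [hVW]; exact hfdiag i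
  have h1 := Matrix.rank_of_isUnit _ hunit
  have h2 := (Matrix.rank_mul_le_left V W).trans (Matrix.rank_le_card_width V)
  rw [h1, Fintype.card_fin, Fintype.card_coe, Finset.card_finsuppAntidiag_nat_eq_choose,
    Finset.card_univ, Fintype.card_fin] at h2
  have h3 : (a + 1 + b - 1).choose b = (a + b).choose a := by
    rw [show a + 1 + b - 1 = a + b by omega]
    exact Nat.choose_symm_add.symm
  rwa [h3] at h2

/-- A skew Bollobás system of type `(a, b)`, written as a list of pairs. -/
structure IsSkewList (a b : ℕ) (L : List (Finset ℕ × Finset ℕ)) : Prop where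
  disjoint : ∀ p ∈ L, Disjoint p.1 p.2
  pairwise : L.Pairwise fun p q => (p.1 ∩ q.2).Nonempty
  card_fst : ∀ p ∈ L, p.1.card ≤ a
  card_snd : ∀ p ∈ L, p.2.card ≤ b

/-- The sum of `f (a - |A|) (b - |B|)` over the pairs `(A, B)` of a list. -/
def defectSum (f : ℕ → ℕ → ℕ) (a b : ℕ) (L : List (Finset ℕ × Finset ℕ)) : ℕ :=
  (L.map fun p => f (a - p.1.card) (b - p.2.card)).sum

/-- Reverse the order of the pairs and exchange the two sides. -/
def mirror (L : List (Finset ℕ × Finset ℕ)) : List (Finset ℕ × Finset ℕ) :=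
  (L.map Prod.swap).reverse

theorem mem_mirror {L : List (Finset ℕ × Finset ℕ)} {p : Finset ℕ × Finset ℕ} :
    p ∈ mirror L ↔ p.swap ∈ L := by
  simp only [mirror, List.mem_reverse, List.mem_map]
  exact ⟨by rintro ⟨q, hq, rfl⟩; simpa using hq, fun h => ⟨_, h, Prod.swap_swap p⟩⟩

theorem IsSkewList.mirror {a b : ℕ} {L : List (Finset ℕ × Finset ℕ)} (h : IsSkewList a b L) :
    IsSkewList b a (mirror L) where
  disjoint p hp := (h.disjoint _ (mem_mirror.1 hp)).symm
  pairwise := by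
    rw [_root_.mirror, List.pairwise_reverse, List.pairwise_map]
    exact h.pairwise.imp fun {p q} hpq => by
      rw [Finset.inter_comm] at hpq
      exact hpq
  card_fst p hp := h.card_snd _ (mem_mirror.1 hp)
  card_snd p hp := h.card_fst _ (mem_mirror.1 hp)

theorem defectSum_mirror (f : ℕ → ℕ → ℕ) (a b : ℕ) (L : List (Finset ℕ × Finset ℕ)) :
    defectSum f b a (mirror L) = defectSum (fun d e => f e d) a b L := by
  simp [defectSum, mirror, List.sum_reverse, Function.comp_def]

theorem defectSum_nil (f : ℕ → ℕ → ℕ) (a b : ℕ) : defectSum f a b [] = 0 := rfl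

theorem defectSum_cons (f : ℕ → ℕ → ℕ) (a b : ℕ) (p : Finset ℕ × Finset ℕ)
    (L : List (Finset ℕ × Finset ℕ)) :
    defectSum f a b (p :: L) = f (a - p.1.card) (b - p.2.card) + defectSum f a b L := by
  simp [defectSum]

theorem defectSum_append (f : ℕ → ℕ → ℕ) (a b : ℕ) (K L : List (Finset ℕ × Finset ℕ)) :
    defectSum f a b (K ++ L) = defectSum f a b K + defectSum f a b L := by
  simp [defectSum]

theorem IsSkewList.sublist {a b : ℕ} {K L : List (Finset ℕ × Finset ℕ)} (h : IsSkewList a b L)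
    (hK : K.Sublist L) : IsSkewList a b K where
  disjoint p hp := h.disjoint p (hK.subset hp)
  pairwise := h.pairwise.sublist hK
  card_fst p hp := h.card_fst p (hK.subset hp)
  card_snd p hp := h.card_snd p (hK.subset hp)

theorem IsSkewList.length_le {a b : ℕ} {L : List (Finset ℕ × Finset ℕ)}
    (h : IsSkewList a b L) : L.length ≤ (a + b).choose a :=
  card_le_choose_of_skew a b (fun i => (L.get i).1) (fun i => (L.get i).2)
    (fun i => h.disjoint _ (L.get_mem i)) (List.pairwise_iff_get.1 h.pairwise)
    (fun i => h.card_fst _ (L.get_mem i)) (fun i => h.card_snd _ (L.get_mem i))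

/-- Replacing a pair `(A, B)` by `(A ∪ {w}, B), (A, B ∪ {w})` with `w` fresh. -/
theorem IsSkewList.split {a b w : ℕ} {A B : Finset ℕ} {K L : List (Finset ℕ × Finset ℕ)}
    (h : IsSkewList a b (K ++ (A, B) :: L)) (hA : A.card < a) (hB : B.card < b)
    (hwA : w ∉ A) (hwB : w ∉ B) :
    IsSkewList a b (K ++ (insert w A, B) :: (A, insert w B) :: L) := by
  have hd := h.disjoint
  have hp := h.pairwise
  have h1 := h.card_fst
  have h2 := h.card_snd
  simp only [List.mem_append, List.mem_cons, List.pairwise_append, List.pairwise_cons] at *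
  have hdAB : Disjoint A B := hd (A, B) (by simp)
  refine ⟨?_, ?_, ?_, ?_⟩
  · rintro p hp
    simp only [List.mem_append, List.mem_cons] at hp
    rcases hp with hpK | rfl | rfl | hpL
    · exact hd p (Or.inl hpK)
    · exact Finset.disjoint_insert_left.2 ⟨hwB, hdAB⟩
    · exact Finset.disjoint_insert_right.2 ⟨hwA, hdAB⟩
    · exact hd p (Or.inr (Or.inr hpL))
  · simp only [List.mem_cons, List.pairwise_append, List.pairwise_cons]
    refine ⟨hp.1, ⟨?_, ?_, hp.2.1.2⟩, ?_⟩
    · rintro q (rfl | hq)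
      · exact ⟨w, by simp⟩
      · exact (hp.2.1.1 q hq).mono
          (Finset.inter_subset_inter_right (Finset.subset_insert w A))
    · exact hp.2.1.1
    · rintro p hpK q (rfl | rfl | hq)
      · exact hp.2.2 p hpK (A, B) (Or.inl rfl)
      · exact (hp.2.2 p hpK (A, B) (Or.inl rfl)).mono
          (Finset.inter_subset_inter_left (Finset.subset_insert w B))
      · exact hp.2.2 p hpK q (Or.inr hq)
  · rintro p hp
    simp only [List.mem_append, List.mem_cons] at hp
    rcases hp with hpK | rfl | rfl | hpL
    · exact h1 p (Or.inl hpK)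
    · exact (Finset.card_insert_le w A).trans hA
    · exact hA.le
    · exact h1 p (Or.inr (Or.inr hpL))
  · rintro p hp
    simp only [List.mem_append, List.mem_cons] at hp
    rcases hp with hpK | rfl | rfl | hpL
    · exact h2 p (Or.inl hpK)
    · exact hB.le
    · exact (Finset.card_insert_le w B).trans hB
    · exact h2 p (Or.inr (Or.inr hpL))

/-- Weighted form of the skew Bollobás theorem. -/
theorem IsSkewList.defectSum_choose_le {a b : ℕ} {L : List (Finset ℕ × Finset ℕ)}
    (h : IsSkewList a b L) : defectSum (fun d e => (d + e).choose d) a b L ≤ (a + b).choose a := by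
  induction hn : defectSum (fun d e => 3 ^ (d + e)) a b L using Nat.strong_induction_on
    generalizing L with
  | _ n ih =>
    by_cases hL : ∃ p ∈ L, p.1.card < a ∧ p.2.card < b
    · obtain ⟨⟨A, B⟩, hp, hA, hB⟩ := hL
      obtain ⟨K, L, rfl⟩ := List.append_of_mem hp
      obtain ⟨w, hw⟩ := Infinite.exists_notMem_finset (A ∪ B)
      rw [Finset.mem_union, not_or] at hw
      change A.card < a at hA
      change B.card < b at hB
      have key := ih _ ?_ (h.split hA hB hw.1 hw.2) rfl
      · refine le_of_eq_of_le ?_ key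
        simp only [defectSum_append, defectSum_cons, Finset.card_insert_of_notMem hw.1,
          Finset.card_insert_of_notMem hw.2]
        obtain ⟨d, hd⟩ := Nat.exists_eq_add_of_lt hA
        obtain ⟨e, he⟩ := Nat.exists_eq_add_of_lt hB
        rw [show a - A.card = d + 1 by omega, show b - B.card = e + 1 by omega,
          show a - (A.card + 1) = d by omega, show b - (B.card + 1) = e by omega,
          show d + 1 + (e + 1) = d + e + 1 + 1 by omega, Nat.choose_succ_succ',
          show d + (e + 1) = d + e + 1 by omega, show d + 1 + e = d + e + 1 by omega]
        omega
      · rw [← hn]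
        simp only [defectSum_append, defectSum_cons, Finset.card_insert_of_notMem hw.1,
          Finset.card_insert_of_notMem hw.2]
        obtain ⟨d, hd⟩ := Nat.exists_eq_add_of_lt hA
        obtain ⟨e, he⟩ := Nat.exists_eq_add_of_lt hB
        rw [show a - A.card = d + 1 by omega, show b - B.card = e + 1 by omega,
          show a - (A.card + 1) = d by omega, show b - (B.card + 1) = e by omega,
          show d + 1 + (e + 1) = d + e + 1 + 1 by omega,
          show d + (e + 1) = d + e + 1 by omega, show d + 1 + e = d + e + 1 by omega,
          pow_succ 3 (d + e + 1)]
        have : 0 < 3 ^ (d + e + 1) := by positivity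
        omega
    · push Not at hL
      refine le_of_eq_of_le ?_ h.length_le
      rw [defectSum, List.map_congr_left (g := fun _ => 1)]
      · simp
      · intro p hp
        rcases lt_or_ge p.1.card a with h1 | h1
        · have := hL p hp h1
          simp [Nat.sub_eq_zero_of_le this]
        · simp [Nat.sub_eq_zero_of_le h1]

theorem defectSum_filter (f : ℕ → ℕ → ℕ) (a b : ℕ) (L : List (Finset ℕ × Finset ℕ))
    (hf : ∀ e, f 0 e = 0) :
    defectSum f a b (L.filter fun p => p.1.card < a) = defectSum f a b L := by
  induction L with
  | nil => rfl
  | cons p L ih =>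
    by_cases hp : p.1.card < a
    · simp [hp, defectSum_cons, ih]
    · simp [hp, defectSum_cons, ih, Nat.sub_eq_zero_of_le (not_lt.1 hp), hf]

theorem IsSkewList.defectSum_choose_succ_le {a b : ℕ} {L : List (Finset ℕ × Finset ℕ)}
    (h : IsSkewList a b L) :
    defectSum (fun d e => (d + e).choose (e + 1)) a b L ≤ (a + b).choose (b + 1) := by
  rw [← defectSum_filter _ _ _ _ (fun e => by simp)]
  cases a with
  | zero => simp [defectSum]
  | succ a =>
    have h' : IsSkewList a (b + 1) (L.filter fun p => p.1.card < a + 1) := by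
      have h0 := h.sublist (List.filter_sublist (p := fun p => p.1.card < a + 1))
      refine ⟨h0.disjoint, h0.pairwise, fun p hp => ?_, fun p hp => ?_⟩
      · have := (List.mem_filter.1 hp).2
        simp at this
        omega
      · have := h0.card_snd p hp
        omega
    have key := h'.defectSum_choose_le
    rw [show a + (b + 1) = a + 1 + b by omega] at key
    refine (le_of_eq ?_).trans (key.trans_eq ?_)
    · refine congrArg List.sum (List.map_congr_left fun p hp => ?_)
      have h1 := h'.card_fst p hp
      have h2 := h.card_snd p (List.mem_filter.1 hp).1
      obtain ⟨d, hd⟩ := Nat.exists_eq_add_of_le h1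
      obtain ⟨e, he⟩ := Nat.exists_eq_add_of_le h2
      rw [show a + 1 - p.1.card = d + 1 by omega, show b - p.2.card = e by omega,
        show a - p.1.card = d by omega, show b + 1 - p.2.card = e + 1 by omega]
      change (d + 1 + e).choose (e + 1) = (d + (e + 1)).choose d
      rw [show d + 1 + e = d + (e + 1) by omega]
      exact Nat.choose_symm_add.symm
    · rw [show a + 1 + b = a + (b + 1) by omega]
      exact Nat.choose_symm_add

/-- The recursively defined value of `n_skew a b`. -/
def skewBound : ℕ → ℕ → ℕ
  | 0, e => e
  | d + 1, 0 => d + 1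
  | d + 1, e + 1 => skewBound d (e + 1) + skewBound (d + 1) e + 1

theorem skewBound_zero_left (e : ℕ) : skewBound 0 e = e := by
  simp [skewBound]

theorem skewBound_zero_right (d : ℕ) : skewBound d 0 = d := by
  cases d <;> simp [skewBound]

theorem skewBound_succ_succ (d e : ℕ) :
    skewBound (d + 1) (e + 1) = skewBound d (e + 1) + skewBound (d + 1) e + 1 := by
  rw [skewBound]

theorem skewBound_comm (d e : ℕ) : skewBound d e = skewBound e d := by
  induction d generalizing e with
  | zero => rw [skewBound_zero_left, skewBound_zero_right]
  | succ d ihd =>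
    induction e with
    | zero => rw [skewBound_zero_left, skewBound_zero_right]
    | succ e ihe => rw [skewBound_succ_succ, skewBound_succ_succ, ihd, ihe]; omega

theorem skewBound_lt_succ_left (d e : ℕ) : skewBound d e < skewBound (d + 1) e := by
  cases e with
  | zero => simp [skewBound_zero_right]
  | succ e => rw [skewBound_succ_succ]; omega

theorem skewBound_strictMono_left (e : ℕ) : StrictMono fun d => skewBound d e :=
  strictMono_nat_of_lt_succ fun d => skewBound_lt_succ_left d e

theorem skewBound_add_one (d e : ℕ) :
    skewBound d e + 1 =
      (d + e).choose (e + 1) + (d + e).choose d + (d + e).choose (d + 1) := by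
  induction d generalizing e with
  | zero => simp [skewBound_zero_left]; omega
  | succ d ihd =>
    induction e with
    | zero => simp [skewBound_zero_right]
    | succ e ihe =>
      have h := ihd (e + 1)
      rw [skewBound_succ_succ, show d + 1 + (e + 1) = d + e + 1 + 1 by omega,
        Nat.choose_succ_succ', Nat.choose_succ_succ' _ d, Nat.choose_succ_succ' _ (d + 1)]
      rw [show d + (e + 1) = d + e + 1 by omega] at h
      rw [show d + 1 + e = d + e + 1 by omega] at ihe
      have h1 : (d + e + 1).choose (e + 1) = (d + e + 1).choose d := by
        rw [show d + e + 1 = d + (e + 1) by omega]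
        exact Nat.choose_symm_add.symm
      have h2 : (d + e + 1).choose (d + 1) = (d + e + 1).choose e := by
        rw [show d + e + 1 = (d + 1) + e by omega]
        exact Nat.choose_symm_add
      omega

theorem skewBound_eq (a b : ℕ) :
    skewBound a b = (a + b + 2).choose (a + 1) - (a + b).choose a - 1 := by
  have h := skewBound_add_one a b
  rw [Nat.choose_succ_succ' (a + b + 1) a, Nat.choose_succ_succ' _ a]
  cases a with
  | zero => simp [skewBound_zero_left]
  | succ a =>
    have h1 : (a + 1 + b).choose (b + 1) = (a + 1 + b).choose a := by
      rw [show a + 1 + b = a + (b + 1) by omega]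
      exact Nat.choose_symm_add.symm
    rw [show a + 1 + b + 1 = (a + 1 + b) + 1 from rfl, Nat.choose_succ_succ']
    omega

theorem IsSkewList.defectSum_skewBound_le {a b : ℕ} {L : List (Finset ℕ × Finset ℕ)}
    (h : IsSkewList a b L) : defectSum skewBound a b L + L.length ≤ skewBound a b + 1 := by
  have h1 := h.defectSum_choose_succ_le
  have h2 := h.defectSum_choose_le
  have h3 := h.mirror.defectSum_choose_succ_le
  rw [defectSum_mirror] at h3
  have h4 : defectSum skewBound a b L + L.length =
      defectSum (fun d e => (d + e).choose (e + 1)) a b L +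
        defectSum (fun d e => (d + e).choose d) a b L +
        defectSum (fun d e => (e + d).choose (d + 1)) a b L := by
    clear h h1 h2 h3
    induction L with
    | nil => rfl
    | cons p L ih =>
      have := skewBound_add_one (a - p.1.card) (b - p.2.card)
      simp only [defectSum_cons, List.length_cons]
      rw [Nat.add_comm (b - p.2.card) (a - p.1.card)]
      omega
  rw [h4, skewBound_add_one]
  rw [Nat.add_comm b a] at h3
  omega

/-- The ground set of a list of pairs. -/
def ground (L : List (Finset ℕ × Finset ℕ)) : Finset ℕ :=
  L.toFinset.biUnion fun p => p.1 ∪ p.2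

theorem mem_ground {L : List (Finset ℕ × Finset ℕ)} {x : ℕ} :
    x ∈ ground L ↔ ∃ p ∈ L, x ∈ p.1 ∨ x ∈ p.2 := by
  simp only [ground, Finset.mem_biUnion, List.mem_toFinset, Finset.mem_union]

theorem ground_mirror (L : List (Finset ℕ × Finset ℕ)) : ground (mirror L) = ground L := by
  ext x
  simp only [mem_ground, mem_mirror]
  constructor
  · rintro ⟨p, hp, hx⟩
    exact ⟨p.swap, hp, hx.symm⟩
  · rintro ⟨p, hp, hx⟩
    exact ⟨p.swap, by simpa using hp, hx.symm⟩

/-- The total size of a list of pairs, also counting the pairs themselves. -/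
def totalSize (L : List (Finset ℕ × Finset ℕ)) : ℕ :=
  (L.map fun p => p.1.card + p.2.card + 1).sum

theorem totalSize_mirror (L : List (Finset ℕ × Finset ℕ)) :
    totalSize (mirror L) = totalSize L := by
  simp only [totalSize, mirror, List.map_reverse, List.sum_reverse, List.map_map]
  congr 1
  refine List.map_congr_left fun p _ => ?_
  simp [Nat.add_comm]

/-- Remove `x` from all first components. -/
def eraseFst (x : ℕ) (L : List (Finset ℕ × Finset ℕ)) : List (Finset ℕ × Finset ℕ) :=
  L.map fun p => (p.1.erase x, p.2)

theorem IsSkewList.eraseFst {a b x : ℕ} {L : List (Finset ℕ × Finset ℕ)}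
    (h : IsSkewList a b L) (hx : ∀ p ∈ L, x ∉ p.2) : IsSkewList a b (eraseFst x L) where
  disjoint := by
    simp only [_root_.eraseFst, List.forall_mem_map]
    exact fun p hp => (h.disjoint p hp).mono_left (Finset.erase_subset _ _)
  pairwise := by
    rw [_root_.eraseFst, List.pairwise_map]
    refine h.pairwise.imp_of_mem fun {p q} _ hq ⟨y, hy⟩ => ⟨y, ?_⟩
    rw [Finset.mem_inter] at hy ⊢
    refine ⟨Finset.mem_erase.2 ⟨?_, hy.1⟩, hy.2⟩
    rintro rfl
    exact hx q hq hy.2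
  card_fst := by
    simp only [_root_.eraseFst, List.forall_mem_map]
    exact fun p hp => Finset.card_erase_le.trans (h.card_fst p hp)
  card_snd := by
    simp only [_root_.eraseFst, List.forall_mem_map]
    exact h.card_snd

theorem totalSize_eraseFst_lt {x : ℕ} {L : List (Finset ℕ × Finset ℕ)}
    (hx : ∃ p ∈ L, x ∈ p.1) : totalSize (eraseFst x L) < totalSize L := by
  rw [totalSize, eraseFst, List.map_map]
  refine List.sum_lt_sum _ _ (fun p _ => ?_) ?_
  · have := Finset.card_erase_le (s := p.1) (a := x)
    simpa using this
  · obtain ⟨p, hp, hxp⟩ := hx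
    refine ⟨p, hp, ?_⟩
    have := Finset.card_erase_lt_of_mem hxp
    simpa using this

theorem card_ground_le_eraseFst (x : ℕ) (L : List (Finset ℕ × Finset ℕ)) :
    (ground L).card ≤ (ground (eraseFst x L)).card + 1 := by
  refine (Finset.card_le_card fun y hy => ?_).trans (Finset.card_insert_le x _)
  rw [Finset.mem_insert, or_iff_not_imp_left]
  intro hyx
  obtain ⟨p, hp, h⟩ := mem_ground.1 hy
  refine mem_ground.2 ⟨(p.1.erase x, p.2), List.mem_map_of_mem hp, ?_⟩
  simpa [hyx] using h

theorem IsSkewList.defectSum_lt_eraseFst {a b x : ℕ} {L : List (Finset ℕ × Finset ℕ)}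
    (h : IsSkewList a b L) (hx : ∃ p ∈ L, x ∈ p.1) :
    defectSum skewBound a b L < defectSum skewBound a b (_root_.eraseFst x L) := by
  rw [defectSum, defectSum, _root_.eraseFst, List.map_map]
  refine List.sum_lt_sum _ _ (fun p _ => ?_) ?_
  · have := Finset.card_erase_le (s := p.1) (a := x)
    exact (skewBound_strictMono_left _).monotone (Nat.sub_le_sub_left this a)
  · obtain ⟨p, hp, hxp⟩ := hx
    refine ⟨p, hp, skewBound_strictMono_left _ ?_⟩
    have h1 := Finset.card_erase_lt_of_mem hxp
    have h2 := h.card_fst p hp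
    change a - p.1.card < a - (p.1.erase x).card
    omega

/-- `skewBound (d - 1) e`, or `0` when `d = 0`. -/
def lowerBound : ℕ → ℕ → ℕ
  | 0, _ => 0
  | d + 1, e => skewBound d e

theorem skewBound_le_lowerBound_add (d e : ℕ) :
    skewBound d e ≤ lowerBound d e + lowerBound e d + 1 := by
  cases d with
  | zero => cases e <;> simp [lowerBound, skewBound_zero_left, skewBound_zero_right]
  | succ d =>
    cases e with
    | zero => simp [lowerBound, skewBound_zero_right]
    | succ e =>
      rw [skewBound_succ_succ, lowerBound, lowerBound, skewBound_comm e]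

theorem defectSum_skewBound_le_lowerBound (a b : ℕ) (L : List (Finset ℕ × Finset ℕ)) :
    defectSum skewBound a b L ≤
      defectSum lowerBound a b L + defectSum lowerBound b a (mirror L) + L.length := by
  rw [defectSum_mirror]
  induction L with
  | nil => exact le_rfl
  | cons p L ih =>
    have := skewBound_le_lowerBound_add (a - p.1.card) (b - p.2.card)
    simp only [defectSum_cons, List.length_cons]
    omega

/-- Lowering `a` by one: drop an element from each full `A` whenever the system stays skew, and
discard the pair otherwise. The set `X` collects the dropped elements. -/
theorem IsSkewList.exists_lower {a b : ℕ} {L : List (Finset ℕ × Finset ℕ)}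
    (h : IsSkewList (a + 1) b L) (hL : ∀ p ∈ L, p.1.card < a + 1 ∨ p.2.card < b) :
    ∃ (R : List (Finset ℕ × Finset ℕ)) (X : Finset ℕ), IsSkewList a b R ∧
      (∀ q ∈ R, ∃ p ∈ L, q.2 = p.2) ∧ (∀ p ∈ L, p.1 ⊆ ground R ∪ X) ∧
      defectSum lowerBound (a + 1) b L + X.card ≤ defectSum skewBound a b R := by
  induction L with
  | nil => exact ⟨[], ∅, ⟨by simp, by simp, by simp, by simp⟩, by simp, by simp, le_rfl⟩
  | cons p L ih =>
    obtain ⟨R, X, hR, hRL, hX, hsum⟩ := ih (h.sublist (List.sublist_cons_self p L))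
      fun q hq => hL q (List.mem_cons_of_mem p hq)
    have hmeet : ∀ q ∈ R, (p.1 ∩ q.2).Nonempty := by
      intro q hq
      obtain ⟨q', hq', he⟩ := hRL q hq
      rw [he]
      exact (List.pairwise_cons.1 h.pairwise).1 q' hq'
    have hpd := h.disjoint p List.mem_cons_self
    have hp2 := h.card_snd p List.mem_cons_self
    have hp1 := h.card_fst p List.mem_cons_self
    have skew_cons : ∀ A ⊆ p.1, A.card ≤ a → (∀ q ∈ R, (A ∩ q.2).Nonempty) →
        IsSkewList a b ((A, p.2) :: R) := by
      intro A hA hcard hAR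
      refine ⟨?_, List.pairwise_cons.2 ⟨hAR, hR.pairwise⟩, ?_, ?_⟩ <;>
        simp only [List.forall_mem_cons]
      · exact ⟨hpd.mono_left hA, hR.disjoint⟩
      · exact ⟨hcard, hR.card_fst⟩
      · exact ⟨hp2, hR.card_snd⟩
    have snd : ∀ A : Finset ℕ, ∀ q ∈ (A, p.2) :: R, ∃ p' ∈ p :: L, q.2 = p'.2 := by
      intro A q hq
      rcases List.mem_cons.1 hq with rfl | hq
      · exact ⟨p, List.mem_cons_self, rfl⟩
      · obtain ⟨q', hq', he⟩ := hRL q hq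
        exact ⟨q', List.mem_cons_of_mem _ hq', he⟩
    have ground_sub : ∀ A : Finset ℕ, ground R ⊆ ground ((A, p.2) :: R) := by
      intro A y hy
      obtain ⟨q, hq, h⟩ := mem_ground.1 hy
      exact mem_ground.2 ⟨q, List.mem_cons_of_mem _ hq, h⟩
    have sub_ground : ∀ A : Finset ℕ, A ⊆ ground ((A, p.2) :: R) := fun A y hy =>
      mem_ground.2 ⟨_, List.mem_cons_self, Or.inl hy⟩
    rcases Nat.lt_or_ge p.1.card (a + 1) with hlt | hge
    · refine ⟨p :: R, X, skew_cons p.1 subset_rfl (by omega) hmeet, snd p.1, ?_, ?_⟩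
      · rw [List.forall_mem_cons]
        exact ⟨(sub_ground p.1).trans Finset.subset_union_left,
          fun q hq => (hX q hq).trans (Finset.union_subset_union_left (ground_sub p.1))⟩
      · rw [defectSum_cons, defectSum_cons,
          show a + 1 - p.1.card = (a - p.1.card) + 1 by omega, lowerBound]
        omega
    · have hzero : a + 1 - p.1.card = 0 := by omega
      have hlt : p.2.card < b := (hL p List.mem_cons_self).resolve_left (by omega)
      by_cases hw : ∃ w ∈ p.1, ∀ q ∈ R, (p.1.erase w ∩ q.2).Nonempty
      · obtain ⟨w, hw, hwR⟩ := hw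
        have hcard := Finset.card_erase_of_mem hw
        refine ⟨(p.1.erase w, p.2) :: R, insert w X,
          skew_cons _ (Finset.erase_subset _ _) (by omega) hwR, snd _, ?_, ?_⟩
        · rw [List.forall_mem_cons]
          refine ⟨fun y hy => ?_, fun q hq => (hX q hq).trans
            (Finset.union_subset_union (ground_sub _) (Finset.subset_insert _ _))⟩
          rcases eq_or_ne y w with rfl | hyw
          · exact Finset.mem_union_right _ (Finset.mem_insert_self _ _)
          · exact Finset.mem_union_left _ (sub_ground _ (Finset.mem_erase.2 ⟨hyw, hy⟩))
        · have := Finset.card_insert_le w X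
          rw [defectSum_cons, defectSum_cons, hzero, lowerBound]
          simp only
          rw [show a - (p.1.erase w).card = 0 by omega, skewBound_zero_left]
          omega
      · push Not at hw
        refine ⟨R, X, hR, fun q hq => ?_, ?_, ?_⟩
        · obtain ⟨q', hq', he⟩ := hRL q hq
          exact ⟨q', List.mem_cons_of_mem _ hq', he⟩
        · rw [List.forall_mem_cons]
          refine ⟨fun w hwp => Finset.mem_union_left _ ?_, hX⟩
          obtain ⟨q, hq, hempty⟩ := hw w hwp
          obtain ⟨y, hy⟩ := hmeet q hq
          rw [Finset.mem_inter] at hy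
          refine mem_ground.2 ⟨q, hq, Or.inr ?_⟩
          by_cases hyw : y = w
          · exact hyw ▸ hy.2
          · exact absurd (Finset.mem_inter.2 ⟨Finset.mem_erase.2 ⟨hyw, hy.1⟩, hy.2⟩)
              (hempty ▸ Finset.notMem_empty y)
        · rw [defectSum_cons, hzero, lowerBound]
          omega

theorem IsSkewList.card_ground_add_defectSum_le {a b : ℕ} {L : List (Finset ℕ × Finset ℕ)}
    (h : IsSkewList a b L) : (ground L).card + defectSum skewBound a b L ≤ skewBound a b := by
  induction hn : a + b using Nat.strong_induction_on generalizing a b L with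
  | _ n ihn =>
  induction hs : totalSize L using Nat.strong_induction_on generalizing a b L with
  | _ s ihs =>
  have oneSided : ∀ {a b : ℕ} {L : List (Finset ℕ × Finset ℕ)}, IsSkewList a b L → a + b = n →
      totalSize L = s → ∀ x, (∃ p ∈ L, x ∈ p.1) → (∀ p ∈ L, x ∉ p.2) →
      (ground L).card + defectSum skewBound a b L ≤ skewBound a b := by
    intro a b L h hn hs x hx1 hx2
    have key := ihs _ (hs ▸ totalSize_eraseFst_lt hx1) (h.eraseFst hx2) hn rfl
    have h1 := card_ground_le_eraseFst x L
    have h2 := h.defectSum_lt_eraseFst hx1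
    omega
  by_cases hA : ∃ x, (∃ p ∈ L, x ∈ p.1) ∧ ∀ p ∈ L, x ∉ p.2
  · obtain ⟨x, hx1, hx2⟩ := hA
    exact oneSided h hn hs x hx1 hx2
  by_cases hB : ∃ x, (∃ p ∈ L, x ∈ p.2) ∧ ∀ p ∈ L, x ∉ p.1
  · obtain ⟨x, ⟨p, hp, hx1⟩, hx2⟩ := hB
    have key := oneSided h.mirror (by omega) (by rw [totalSize_mirror, hs]) x
      ⟨p.swap, mem_mirror.2 (by simpa using hp), hx1⟩
      fun q hq => hx2 _ (mem_mirror.1 hq)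
    rw [ground_mirror, defectSum_mirror, skewBound_comm b a] at key
    rwa [show (fun d e => skewBound e d) = skewBound from
      funext₂ fun d e => skewBound_comm e d] at key
  push Not at hA hB
  by_cases hfull : ∃ p ∈ L, a ≤ p.1.card ∧ b ≤ p.2.card
  · obtain ⟨p, hp, hpa, hpb⟩ := hfull
    obtain ⟨K, L, rfl⟩ := List.append_of_mem hp
    have hsub : (K ++ L).Sublist (K ++ p :: L) :=
      (List.Sublist.refl K).append (List.sublist_cons_self p L)
    have key := ihs (totalSize (K ++ L)) (by simp [← hs, totalSize]) (h.sublist hsub) hn rfl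
    have hpd := h.disjoint p hp
    have hground : ground (K ++ p :: L) ⊆ ground (K ++ L) := by
      intro x hx
      obtain ⟨q, hq, hxq⟩ := mem_ground.1 hx
      have other : ∀ q ∈ K ++ p :: L, q ≠ p → x ∈ q.1 ∨ x ∈ q.2 → x ∈ ground (K ++ L) := by
        intro q hq hne hxq
        refine mem_ground.2 ⟨q, ?_, hxq⟩
        simpa [hne] using hq
      by_cases hqp : q = p
      · subst hqp
        rcases hxq with hx1 | hx2
        · obtain ⟨r, hr, hxr⟩ := hA x ⟨q, hq, hx1⟩
          refine other r hr ?_ (Or.inr hxr)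
          rintro rfl
          exact Finset.disjoint_left.1 hpd hx1 hxr
        · obtain ⟨r, hr, hxr⟩ := hB x ⟨q, hq, hx2⟩
          refine other r hr ?_ (Or.inl hxr)
          rintro rfl
          exact Finset.disjoint_left.1 hpd hxr hx2
      · exact other q hq hqp hxq
    have hcard := Finset.card_le_card hground
    rw [defectSum_append] at key ⊢
    rw [defectSum_cons, Nat.sub_eq_zero_of_le hpa, Nat.sub_eq_zero_of_le hpb,
      skewBound_zero_left]
    omega
  push Not at hfull
  by_cases hcard : (ground L).card + 1 ≤ L.length
  · have := h.defectSum_skewBound_le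
    omega
  rcases (ground L).eq_empty_or_nonempty with hempty | ⟨x, hx⟩
  · have : L = [] := by
      rw [hempty, Finset.card_empty] at hcard
      exact List.length_eq_zero_iff.1 (by omega)
    subst this
    simp [hempty, defectSum_nil]
  have both : ∀ x ∈ ground L, (∃ p ∈ L, x ∈ p.1) ∧ ∃ p ∈ L, x ∈ p.2 := by
    intro x hx
    obtain ⟨p, hp, h1 | h2⟩ := mem_ground.1 hx
    · exact ⟨⟨p, hp, h1⟩, hA x ⟨p, hp, h1⟩⟩
    · exact ⟨hB x ⟨p, hp, h2⟩, ⟨p, hp, h2⟩⟩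
  obtain ⟨⟨p, hp, hxp⟩, q, hq, hxq⟩ := both x hx
  have hapos := (Finset.card_pos.2 ⟨x, hxp⟩).trans_le (h.card_fst p hp)
  have hbpos := (Finset.card_pos.2 ⟨x, hxq⟩).trans_le (h.card_snd q hq)
  obtain ⟨a, rfl⟩ := Nat.exists_eq_add_one_of_ne_zero hapos.ne'
  obtain ⟨b, rfl⟩ := Nat.exists_eq_add_one_of_ne_zero hbpos.ne'
  obtain ⟨R, X, hR, -, hX, hsum⟩ := h.exists_lower fun p hp => by
    have := hfull p hp
    omega
  obtain ⟨R', X', hR', -, hX', hsum'⟩ := h.mirror.exists_lower fun p hp => by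
    have := hfull _ (mem_mirror.1 hp)
    simp only [Prod.fst_swap, Prod.snd_swap] at this
    omega
  have hV : (ground L).card ≤ (ground R).card + X.card :=
    (Finset.card_le_card fun x hx => by
      obtain ⟨p, hp, hxp⟩ := (both x hx).1
      exact hX p hp hxp).trans (Finset.card_union_le _ _)
  have hV' : (ground L).card ≤ (ground R').card + X'.card :=
    (Finset.card_le_card fun x hx => by
      obtain ⟨p, hp, hxp⟩ := (both x hx).2
      exact hX' p.swap (mem_mirror.2 (by simpa using hp)) hxp).trans (Finset.card_union_le _ _)
  have key := ihn (a + (b + 1)) (by omega) hR rfl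
  have key' := ihn (b + (a + 1)) (by omega) hR' rfl
  have hsplit := defectSum_skewBound_le_lowerBound (a + 1) (b + 1) L
  rw [skewBound_comm b] at key'
  rw [skewBound_succ_succ]
  omega

/-- Relabel the elements of a list of pairs. -/
def relabel (f : ℕ ↪ ℕ) (L : List (Finset ℕ × Finset ℕ)) : List (Finset ℕ × Finset ℕ) :=
  L.map fun p => (p.1.map f, p.2.map f)

theorem IsSkewList.relabel {a b : ℕ} {L : List (Finset ℕ × Finset ℕ)} (h : IsSkewList a b L)
    (f : ℕ ↪ ℕ) : IsSkewList a b (relabel f L) := by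
  refine ⟨?_, ?_, ?_, ?_⟩
  · simp only [_root_.relabel, List.forall_mem_map, Finset.disjoint_map]
    exact h.disjoint
  · rw [_root_.relabel, List.pairwise_map]
    refine h.pairwise.imp fun {p q} hpq => ?_
    rw [← Finset.map_inter]
    exact hpq.map
  · simp only [_root_.relabel, List.forall_mem_map, Finset.card_map]
    exact h.card_fst
  · simp only [_root_.relabel, List.forall_mem_map, Finset.card_map]
    exact h.card_snd

theorem ground_relabel (f : ℕ ↪ ℕ) (L : List (Finset ℕ × Finset ℕ)) :
    ground (relabel f L) = (ground L).map f := by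
  ext x
  simp only [mem_ground, relabel, List.mem_map, Finset.mem_map]
  constructor
  · rintro ⟨_, ⟨p, hp, rfl⟩, hx⟩
    simp only [Finset.mem_map] at hx
    rcases hx with ⟨y, hy, rfl⟩ | ⟨y, hy, rfl⟩
    · exact ⟨y, ⟨p, hp, Or.inl hy⟩, rfl⟩
    · exact ⟨y, ⟨p, hp, Or.inr hy⟩, rfl⟩
  · rintro ⟨y, ⟨p, hp, hy⟩, rfl⟩
    exact ⟨_, ⟨p, hp, rfl⟩, by simpa using hy⟩

/-- Add `z` to all first components. -/
def insertFst (z : ℕ) (L : List (Finset ℕ × Finset ℕ)) : List (Finset ℕ × Finset ℕ) :=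
  L.map fun p => (insert z p.1, p.2)

/-- Add `z` to all second components. -/
def insertSnd (z : ℕ) (L : List (Finset ℕ × Finset ℕ)) : List (Finset ℕ × Finset ℕ) :=
  L.map fun p => (p.1, insert z p.2)

theorem IsSkewList.insertFst_append_insertSnd {a b z : ℕ} {K L : List (Finset ℕ × Finset ℕ)}
    (hK : IsSkewList a (b + 1) K) (hL : IsSkewList (a + 1) b L) (hzK : z ∉ ground K)
    (hzL : z ∉ ground L) : IsSkewList (a + 1) (b + 1) (insertFst z K ++ insertSnd z L) := by
  have hzK' : ∀ p ∈ K, z ∉ p.2 := fun p hp hz => hzK (mem_ground.2 ⟨p, hp, Or.inr hz⟩)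
  have hzL' : ∀ p ∈ L, z ∉ p.1 := fun p hp hz => hzL (mem_ground.2 ⟨p, hp, Or.inl hz⟩)
  refine ⟨?_, ?_, ?_, ?_⟩
  · simp only [insertFst, insertSnd, List.forall_mem_append, List.forall_mem_map]
    exact ⟨fun p hp => Finset.disjoint_insert_left.2 ⟨hzK' p hp, hK.disjoint p hp⟩,
      fun p hp => Finset.disjoint_insert_right.2 ⟨hzL' p hp, hL.disjoint p hp⟩⟩
  · simp only [insertFst, insertSnd, List.pairwise_append, List.pairwise_map,
      List.forall_mem_map]
    refine ⟨hK.pairwise.imp fun {p q} hpq => ?_, hL.pairwise.imp fun {p q} hpq => ?_, ?_⟩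
    · exact hpq.mono (Finset.inter_subset_inter_right (Finset.subset_insert z p.1))
    · exact hpq.mono (Finset.inter_subset_inter_left (Finset.subset_insert z q.2))
    · exact fun p _ q _ => ⟨z, by simp⟩
  · simp only [insertFst, insertSnd, List.forall_mem_append, List.forall_mem_map]
    exact ⟨fun p hp => (Finset.card_insert_le z p.1).trans (Nat.succ_le_succ (hK.card_fst p hp)),
      hL.card_fst⟩
  · simp only [insertFst, insertSnd, List.forall_mem_append, List.forall_mem_map]
    exact ⟨hK.card_snd,
      fun p hp => (Finset.card_insert_le z p.2).trans (Nat.succ_le_succ (hL.card_snd p hp))⟩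

theorem insert_ground_subset {z : ℕ} {K L : List (Finset ℕ × Finset ℕ)} (hK : K ≠ []) :
    insert z (ground K ∪ ground L) ⊆ ground (insertFst z K ++ insertSnd z L) := by
  intro x hx
  simp only [Finset.mem_insert, Finset.mem_union, mem_ground] at hx
  simp only [mem_ground, insertFst, insertSnd, List.mem_append, List.mem_map]
  rcases hx with rfl | ⟨p, hp, hx⟩ | ⟨p, hp, hx⟩
  · obtain ⟨p, hp⟩ := List.exists_mem_of_ne_nil K hK
    exact ⟨_, Or.inl ⟨p, hp, rfl⟩, by simp⟩
  · refine ⟨_, Or.inl ⟨p, hp, rfl⟩, ?_⟩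
    simp only [Finset.mem_insert]
    tauto
  · refine ⟨_, Or.inr ⟨p, hp, rfl⟩, ?_⟩
    simp only [Finset.mem_insert]
    tauto

theorem exists_isSkewList (a b : ℕ) : ∃ L : List (Finset ℕ × Finset ℕ), L ≠ [] ∧
    IsSkewList a b L ∧ skewBound a b ≤ (ground L).card := by
  induction a generalizing b with
  | zero =>
    refine ⟨[(∅, Finset.range b)], by simp, ⟨by simp, by simp, by simp, by simp⟩, ?_⟩
    simp [ground, skewBound_zero_left]
  | succ a iha =>
    induction b with
    | zero =>
      refine ⟨[(Finset.range (a + 1), ∅)], by simp, ⟨by simp, by simp, by simp, by simp⟩, ?_⟩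
      simp [ground, skewBound_zero_right]
    | succ b ihb =>
      obtain ⟨K, hK0, hK, hKcard⟩ := iha (b + 1)
      obtain ⟨L, -, hL, hLcard⟩ := ihb
      let f : ℕ ↪ ℕ := ⟨fun n => 2 * n + 1, fun m n h => by simpa using h⟩
      let g : ℕ ↪ ℕ := ⟨fun n => 2 * n + 2, fun m n h => by simpa using h⟩
      have hf : 0 ∉ ground (relabel f K) := by simp [ground_relabel, f]
      have hg : 0 ∉ ground (relabel g L) := by simp [ground_relabel, g]
      have hne : relabel f K ≠ [] := by simpa [relabel] using hK0
      refine ⟨insertFst 0 (relabel f K) ++ insertSnd 0 (relabel g L), by simp [insertFst, hne],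
        (hK.relabel f).insertFst_append_insertSnd (hL.relabel g) hf hg, ?_⟩
      refine le_trans ?_ (Finset.card_le_card (insert_ground_subset hne))
      have hdisj : Disjoint (ground (relabel f K)) (ground (relabel g L)) := by
        rw [ground_relabel, ground_relabel, Finset.disjoint_left]
        simp only [Finset.mem_map]
        rintro _ ⟨m, -, rfl⟩ ⟨n, -, h⟩
        change 2 * n + 2 = 2 * m + 1 at h
        omega
      rw [Finset.card_insert_of_notMem (by simp [hf, hg]), Finset.card_union_of_disjoint hdisj,
        ground_relabel, ground_relabel, Finset.card_map, Finset.card_map, skewBound_succ_succ]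
      omega

/-- `n_skew(a,b) = C(a+b+2, a+1) - C(a+b, a) - 1`: this number is the greatest size of the
ground set `(A 1 ∪ B 1) ∪ ⋯ ∪ (A m ∪ B m)` over all skew Bollobás systems with
`|A i| ≤ a`, `|B i| ≤ b`. -/
theorem nskew_eq (a b : ℕ) :
    IsGreatest {n : ℕ | ∃ (m : ℕ) (A B : Fin m → Finset ℕ),
        IsSkewBollobasSystem m A B ∧ (∀ i, (A i).card ≤ a) ∧ (∀ i, (B i).card ≤ b) ∧
        (Finset.univ.biUnion (fun i => A i ∪ B i)).card = n}
      ((a + b + 2).choose (a + 1) - (a + b).choose a - 1) := by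
  rw [← skewBound_eq]
  constructor
  · obtain ⟨L, -, hL, hcard⟩ := exists_isSkewList a b
    refine ⟨L.length, fun i => (L.get i).1, fun i => (L.get i).2,
      ⟨fun i => hL.disjoint _ (L.get_mem i), List.pairwise_iff_get.1 hL.pairwise⟩,
      fun i => hL.card_fst _ (L.get_mem i), fun i => hL.card_snd _ (L.get_mem i), ?_⟩
    have hground : Finset.univ.biUnion (fun i => (L.get i).1 ∪ (L.get i).2) = ground L := by
      ext x
      simp only [mem_ground, Finset.mem_biUnion, Finset.mem_univ, true_and, Finset.mem_union,
        List.mem_iff_get]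
      constructor
      · rintro ⟨i, hi⟩
        exact ⟨_, ⟨i, rfl⟩, hi⟩
      · rintro ⟨_, ⟨i, rfl⟩, hi⟩
        exact ⟨i, hi⟩
    rw [hground]
    have := hL.card_ground_add_defectSum_le
    omega
  · rintro n ⟨m, A, B, ⟨hdisj, hskew⟩, hA, hB, rfl⟩
    have hL : IsSkewList a b (List.ofFn fun i => (A i, B i)) := by
      refine ⟨?_, List.pairwise_ofFn.2 fun i j hij => hskew i j hij, ?_, ?_⟩ <;>
        simpa only [List.forall_mem_ofFn_iff]
    refine le_trans (Finset.card_le_card fun x hx => ?_)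
      (Nat.le_of_add_right_le hL.card_ground_add_defectSum_le)
    obtain ⟨i, -, hi⟩ := Finset.mem_biUnion.1 hx
    exact mem_ground.2 ⟨(A i, B i), List.mem_ofFn.2 ⟨i, rfl⟩, Finset.mem_union.1 hi⟩
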